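/- Let T_1,…,T_N be quantum channels each satisfying: the minimal output von Neumann entropy of T_k is achieved on states whose convex combination maps under T_k to a maximal-entropy output (so C(T_k) = sup S∘T_k − ν₁(T_k)), and suppose strong additivity of the minimal output entropy holds: ν₁(⊗_k T_k) = Σ_k ν₁(T_k). Then the Holevo capacity is strongly additive: C(⊗_k T_k) = Σ_k C(T_k). -/

import Mathlib

open Matrix BigOperators
open scoped ComplexOrder

noncomputable section

variable {n : Type*} [Fintype n] [DecidableEq n]

/-- A density matrix: positive semidefinite with unit trace. -/
def IsDensity (ρ : Matrix n n ℂ) : Prop := ρ.PosSemidef ∧ ρ.trace = 1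

/-- `tr(ρ^α)` via functional calculus (powers of eigenvalues, with `0^α := 0`). -/
noncomputable def trPow (ρ : Matrix n n ℂ) (α : ℝ) : ℝ :=
  if h : ρ.IsHermitian then ∑ i, if h.eigenvalues i = 0 then 0 else (h.eigenvalues i) ^ α else 0

/-- The von Neumann entropy `-tr(ρ log ρ)` (base-2 logarithm). -/
noncomputable def vN (ρ : Matrix n n ℂ) : ℝ :=
  if h : ρ.IsHermitian then -∑ i, (h.eigenvalues i) * Real.logb 2 (h.eigenvalues i) else 0

/-- The Renyi α-entropy, with the von Neumann entropy at α = 1. -/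
noncomputable def renyi (ρ : Matrix n n ℂ) (α : ℝ) : ℝ :=
  if α = 1 then vN ρ else (1 - α)⁻¹ * Real.logb 2 (trPow ρ α)

/-- Largest eigenvalue (operator norm for positive semidefinite matrices). -/
noncomputable def maxEig (A : Matrix n n ℂ) : ℝ :=
  if h : A.IsHermitian then ⨆ i, h.eigenvalues i else 0

/-- An orthogonal projection. -/
def IsProjection (P : Matrix n n ℂ) : Prop := P.IsHermitian ∧ P * P = P

/-- A normalized projection `P / rank P`. -/
def IsNormalizedProjection (ρ : Matrix n n ℂ) : Prop :=
  ∃ P : Matrix n n ℂ, IsProjection P ∧ ρ = ((P.rank : ℂ))⁻¹ • P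

def TracePreserving (T : Matrix n n ℂ → Matrix n n ℂ) : Prop :=
  ∀ X, (T X).trace = X.trace

def PositiveMap (T : Matrix n n ℂ → Matrix n n ℂ) : Prop :=
  ∀ X, X.PosSemidef → (T X).PosSemidef

/-- The ampliation `T ⊗ id` acting blockwise. -/
def ampl (T : Matrix n n ℂ → Matrix n n ℂ) {k : Type*} [Fintype k] [DecidableEq k]
    (X : Matrix (n × k) (n × k) ℂ) : Matrix (n × k) (n × k) ℂ :=
  fun p q => T (fun a b => X (a, p.2) (b, q.2)) p.1 q.1

def CompletelyPositive (T : Matrix n n ℂ → Matrix n n ℂ) : Prop :=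
  ∀ (N : ℕ) (X : Matrix (n × Fin N) (n × Fin N) ℂ), X.PosSemidef → (ampl T X).PosSemidef

def IsChannel (T : Matrix n n ℂ → Matrix n n ℂ) : Prop :=
  IsLinearMap ℂ T ∧ CompletelyPositive T ∧ TracePreserving T

/-- Minimal output Renyi α-entropy. -/
noncomputable def minOut (T : Matrix n n ℂ → Matrix n n ℂ) (α : ℝ) : ℝ :=
  sInf {x | ∃ ρ, IsDensity ρ ∧ x = renyi (T ρ) α}

/-- Maximal output von Neumann entropy. -/
noncomputable def maxVN (T : Matrix n n ℂ → Matrix n n ℂ) : ℝ :=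
  sSup {x | ∃ ρ, IsDensity ρ ∧ x = vN (T ρ)}

/-- Holevo capacity. -/
noncomputable def holevoCap (T : Matrix n n ℂ → Matrix n n ℂ) : ℝ :=
  sSup {x | ∃ (k : ℕ) (p : Fin k → ℝ) (σ : Fin k → Matrix n n ℂ),
    (∀ i, 0 ≤ p i) ∧ (∑ i, p i = 1) ∧ (∀ i, IsDensity (σ i)) ∧
    x = vN (T (∑ i, (p i : ℂ) • σ i)) - ∑ i, p i * vN (T (σ i))}

/-- Tensor product of matrices indexed by a finite family. -/
def tensorMatrix {N : ℕ} {d : Fin N → Type*} [∀ i, Fintype (d i)] [∀ i, DecidableEq (d i)]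
    (A : ∀ i, Matrix (d i) (d i) ℂ) : Matrix (∀ i, d i) (∀ i, d i) ℂ :=
  fun p q => ∏ i, A i (p i) (q i)

/-- The flip (swap) operator on `ℂ^n ⊗ ℂ^n`. -/
def flipMat : Matrix (n × n) (n × n) ℂ :=
  fun p q => if p.1 = q.2 ∧ p.2 = q.1 then 1 else 0

/-- Partial transpose on the second tensor factor. -/
def pt2 {a b : Type*} (X : Matrix (a × b) (a × b) ℂ) : Matrix (a × b) (a × b) ℂ :=
  fun p q => X (p.1, q.2) (q.1, p.2)

end


namespace HolevoAux

open Finset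

section single

variable {n : Type*} [Fintype n] [DecidableEq n]

lemma vN_of_diag (ρ U : Matrix n n ℂ) (f : n → ℝ) (hU : Uᴴ * U = 1)
    (h : ρ = U * diagonal (fun i => (f i : ℂ)) * Uᴴ) :
    vN ρ = (∑ i, Real.negMulLog (f i)) / Real.log 2 := by
  have hH : ρ.IsHermitian := by
    rw [h, Matrix.IsHermitian, conjTranspose_mul, conjTranspose_mul, conjTranspose_conjTranspose,
      diagonal_conjTranspose, Matrix.mul_assoc]
    congr 2
    congr 1
    ext i
    simp
  have hc : ρ.charpoly = ∏ i, (Polynomial.X - Polynomial.C (f i : ℂ)) := by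
    rw [h, charpoly_mul_comm, ← Matrix.mul_assoc, hU, Matrix.one_mul, charpoly_diagonal]
  have hr := hH.roots_charpoly_eq_eigenvalues
  rw [hc, Polynomial.roots_prod _ _ (by
    simp [Finset.prod_ne_zero_iff, Polynomial.X_sub_C_ne_zero])] at hr
  have hr2 : Multiset.map f univ.val = Multiset.map hH.eigenvalues univ.val := by
    have := congrArg (Multiset.map Complex.re) hr
    simpa using this
  have hs : ∑ i, Real.negMulLog (f i) = ∑ i, Real.negMulLog (hH.eigenvalues i) := by
    have := congrArg (fun m => (Multiset.map Real.negMulLog m).sum) hr2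
    simpa [Multiset.map_map] using this
  rw [hs, vN, dif_pos hH, Finset.sum_div, ← Finset.sum_neg_distrib]
  refine Finset.sum_congr rfl fun i _ => ?_
  rw [Real.negMulLog, Real.logb]
  ring

lemma density_diag (ρ : Matrix n n ℂ) (h : IsDensity ρ) :
    ∃ (U : Matrix n n ℂ) (f : n → ℝ), Uᴴ * U = 1 ∧ U * Uᴴ = 1 ∧
      ρ = U * diagonal (fun i => (f i : ℂ)) * Uᴴ ∧ (∀ i, 0 ≤ f i) ∧ ∑ i, f i = 1 := by
  have hH := h.1.1
  refine ⟨hH.eigenvectorUnitary, hH.eigenvalues, ?_, ?_, ?_, h.1.eigenvalues_nonneg, ?_⟩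
  · exact Unitary.coe_star_mul_self hH.eigenvectorUnitary
  · exact Unitary.coe_mul_star_self hH.eigenvectorUnitary
  · have := hH.spectral_theorem
    rw [Unitary.conjStarAlgAut_apply] at this
    exact this
  · have := hH.trace_eq_sum_eigenvalues
    rw [h.2] at this
    simp only [Complex.coe_algebraMap] at this
    exact_mod_cast this.symm

lemma sum_sq_row (W : Matrix n n ℂ) (h : W * Wᴴ = 1) (p : n) : ∑ i, ‖W p i‖ ^ 2 = 1 := by
  have := congrFun (congrFun h p) p
  simp only [mul_apply, conjTranspose_apply, one_apply_eq, RCLike.star_def, Complex.mul_conj'] at this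
  exact_mod_cast this

lemma sum_sq_col (W : Matrix n n ℂ) (h : Wᴴ * W = 1) (i : n) : ∑ p, ‖W p i‖ ^ 2 = 1 := by
  have := congrFun (congrFun h i) i
  simp only [mul_apply, conjTranspose_apply, one_apply_eq, RCLike.star_def, Complex.conj_mul'] at this
  exact_mod_cast this

lemma vN_le_diag (ρ U : Matrix n n ℂ) (h : IsDensity ρ) (hU : Uᴴ * U = 1) (hU' : U * Uᴴ = 1) :
    vN ρ ≤ (∑ p, Real.negMulLog ((Uᴴ * ρ * U) p p).re) / Real.log 2 := by
  obtain ⟨V, f, hV, hV', hρ, hf, hf1⟩ := density_diag ρ h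
  rw [vN_of_diag ρ V f hV hρ]
  refine div_le_div_of_nonneg_right ?_ (Real.log_nonneg (by norm_num))
  set W := Uᴴ * V with hW
  have hW1 : W * Wᴴ = 1 := by
    rw [hW, conjTranspose_mul, conjTranspose_conjTranspose, Matrix.mul_assoc,
      ← Matrix.mul_assoc V, hV', Matrix.one_mul, hU]
  have hW2 : Wᴴ * W = 1 := by
    rw [hW, conjTranspose_mul, conjTranspose_conjTranspose, Matrix.mul_assoc,
      ← Matrix.mul_assoc U, hU', Matrix.one_mul, hV]
  have hq : ∀ p, ((Uᴴ * ρ * U) p p).re = ∑ i, ‖W p i‖ ^ 2 * f i := by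
    intro p
    have : Uᴴ * ρ * U = W * diagonal (fun i => (f i : ℂ)) * Wᴴ := by
      rw [hρ, hW, conjTranspose_mul, conjTranspose_conjTranspose]
      simp only [Matrix.mul_assoc]
    rw [this, mul_apply]
    simp only [mul_diagonal, conjTranspose_apply, RCLike.star_def, Complex.re_sum]
    refine Finset.sum_congr rfl fun i _ => ?_
    have : W p i * (f i : ℂ) * (starRingEnd ℂ) (W p i) = ((‖W p i‖ ^ 2 * f i : ℝ) : ℂ) := by
      rw [mul_right_comm, Complex.mul_conj']
      push_cast
      rfl
    rw [this, Complex.ofReal_re]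
  have hJ : ∀ p, ∑ i, ‖W p i‖ ^ 2 * Real.negMulLog (f i) ≤ Real.negMulLog ((Uᴴ * ρ * U) p p).re := by
    intro p
    rw [hq p]
    have := Real.concaveOn_negMulLog.le_map_sum (t := univ) (w := fun i => ‖W p i‖ ^ 2) (p := f)
      (fun i _ => by positivity) (sum_sq_row W hW1 p) (fun i _ => hf i)
    simpa using this
  calc ∑ i, Real.negMulLog (f i) = ∑ i, (∑ p, ‖W p i‖ ^ 2) * Real.negMulLog (f i) := by
        simp [sum_sq_col W hW2]
    _ = ∑ p, ∑ i, ‖W p i‖ ^ 2 * Real.negMulLog (f i) := by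
        simp_rw [Finset.sum_mul]
        exact Finset.sum_comm
    _ ≤ _ := Finset.sum_le_sum fun p _ => hJ p

lemma vN_nonneg (ρ : Matrix n n ℂ) (h : IsDensity ρ) : 0 ≤ vN ρ := by
  obtain ⟨V, f, hV, hV', hρ, hf, hf1⟩ := density_diag ρ h
  rw [vN_of_diag ρ V f hV hρ]
  refine div_nonneg (Finset.sum_nonneg fun i _ => Real.negMulLog_nonneg (hf i) ?_)
    (Real.log_nonneg (by norm_num))
  rw [← hf1]
  exact Finset.single_le_sum (fun i _ => hf i) (Finset.mem_univ i)

lemma vN_le (ρ : Matrix n n ℂ) (h : IsDensity ρ) : vN ρ ≤ (Fintype.card n : ℝ) / Real.log 2 := by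
  obtain ⟨V, f, hV, hV', hρ, hf, hf1⟩ := density_diag ρ h
  rw [vN_of_diag ρ V f hV hρ]
  refine div_le_div_of_nonneg_right ?_ (Real.log_nonneg (by norm_num))
  calc ∑ i, Real.negMulLog (f i) ≤ ∑ i : n, (1 : ℝ) :=
        Finset.sum_le_sum fun i _ => (Real.negMulLog_le_one_sub_self (hf i)).trans
          (by linarith [hf i])
    _ = _ := by simp

lemma channel_density (T : Matrix n n ℂ → Matrix n n ℂ) (hT : IsChannel T) (ρ : Matrix n n ℂ)
    (h : IsDensity ρ) : IsDensity (T ρ) := by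
  refine ⟨?_, by rw [hT.2.2, h.2]⟩
  have h1 := hT.2.1 1 (ρ.submatrix Prod.fst Prod.fst) (h.1.submatrix _)
  exact h1.submatrix (fun a => (a, (0 : Fin 1)))

lemma convex_density {k : Type*} [Fintype k] (p : k → ℝ) (σ : k → Matrix n n ℂ)
    (hp : ∀ i, 0 ≤ p i) (h1 : ∑ i, p i = 1) (hσ : ∀ i, IsDensity (σ i)) :
    IsDensity (∑ i, (p i : ℂ) • σ i) := by
  refine ⟨Matrix.posSemidef_sum _ fun i _ => (hσ i).1.smul (by exact_mod_cast hp i), ?_⟩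
  rw [trace_sum]
  simp only [trace_smul, (hσ _).2, smul_eq_mul, mul_one]
  exact_mod_cast h1

lemma bdd_max (T : Matrix n n ℂ → Matrix n n ℂ) (hT : IsChannel T) :
    BddAbove {x | ∃ ρ, IsDensity ρ ∧ x = vN (T ρ)} := by
  refine ⟨(Fintype.card n : ℝ) / Real.log 2, ?_⟩
  rintro x ⟨ρ, hρ, rfl⟩
  exact vN_le _ (channel_density T hT ρ hρ)

lemma vN_le_maxVN (T : Matrix n n ℂ → Matrix n n ℂ) (hT : IsChannel T) (ρ : Matrix n n ℂ)
    (h : IsDensity ρ) : vN (T ρ) ≤ maxVN T :=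
  le_csSup (bdd_max T hT) ⟨ρ, h, rfl⟩

lemma minOut_le (T : Matrix n n ℂ → Matrix n n ℂ) (hT : IsChannel T) (ρ : Matrix n n ℂ)
    (h : IsDensity ρ) : minOut T 1 ≤ vN (T ρ) := by
  refine csInf_le ⟨0, ?_⟩ ⟨ρ, h, by simp [renyi]⟩
  rintro x ⟨ρ, hρ, rfl⟩
  simpa [renyi] using vN_nonneg _ (channel_density T hT ρ hρ)

/-- If the outputs of averages are bounded by `M` and an ensemble attains `M - minOut`,
the capacity is `M - minOut`. -/
lemma cap_eq (T : Matrix n n ℂ → Matrix n n ℂ) (hT : IsChannel T) (M : ℝ)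
    (hM : ∀ ρ, IsDensity ρ → vN (T ρ) ≤ M)
    {k : Type*} [Fintype k] (p : k → ℝ) (σ : k → Matrix n n ℂ)
    (hp : ∀ i, 0 ≤ p i) (h1 : ∑ i, p i = 1) (hσ : ∀ i, IsDensity (σ i))
    (hmin : ∀ i, vN (T (σ i)) ≤ minOut T 1)
    (hmax : M ≤ vN (T (∑ i, (p i : ℂ) • σ i))) :
    holevoCap T = M - minOut T 1 := by
  have hub : ∀ x ∈ {x | ∃ (k : ℕ) (p : Fin k → ℝ) (σ : Fin k → Matrix n n ℂ),
    (∀ i, 0 ≤ p i) ∧ (∑ i, p i = 1) ∧ (∀ i, IsDensity (σ i)) ∧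
    x = vN (T (∑ i, (p i : ℂ) • σ i)) - ∑ i, p i * vN (T (σ i))}, x ≤ M - minOut T 1 := by
    rintro x ⟨k, p, σ, hp, h1, hσ, rfl⟩
    refine sub_le_sub (hM _ (convex_density p σ hp h1 hσ)) ?_
    calc minOut T 1 = ∑ i, p i * minOut T 1 := by rw [← Finset.sum_mul, h1, one_mul]
      _ ≤ _ := Finset.sum_le_sum fun i _ =>
        mul_le_mul_of_nonneg_left (minOut_le T hT _ (hσ i)) (hp i)
  let e := (Fintype.equivFin k).symm
  have hmem : vN (T (∑ i, (p i : ℂ) • σ i)) - ∑ i, p i * vN (T (σ i)) ∈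
    {x | ∃ (k : ℕ) (p : Fin k → ℝ) (σ : Fin k → Matrix n n ℂ),
    (∀ i, 0 ≤ p i) ∧ (∑ i, p i = 1) ∧ (∀ i, IsDensity (σ i)) ∧
    x = vN (T (∑ i, (p i : ℂ) • σ i)) - ∑ i, p i * vN (T (σ i))} := by
    refine ⟨Fintype.card k, p ∘ e, σ ∘ e, fun i => hp _, ?_, fun i => hσ _, ?_⟩
    · rw [← h1]
      exact e.sum_comp p
    · have a1 := e.sum_comp (fun i => (p i : ℂ) • σ i)
      have a2 := e.sum_comp (fun i => p i * vN (T (σ i)))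
      simp only [Function.comp_apply]
      rw [a1, a2]
  apply le_antisymm
  · exact csSup_le ⟨_, hmem⟩ hub
  · refine le_trans ?_ (le_csSup ⟨_, hub⟩ hmem)
    refine sub_le_sub hmax ?_
    calc _ ≤ ∑ i, p i * minOut T 1 := Finset.sum_le_sum fun i _ =>
            mul_le_mul_of_nonneg_left (hmin i) (hp i)
      _ = _ := by rw [← Finset.sum_mul, h1, one_mul]

end single

section tensor

open scoped MatrixOrder Matrix.Norms.L2Operator in
lemma psd_factor {n : Type*} [Fintype n] [DecidableEq n] {A : Matrix n n ℂ} (h : A.PosSemidef) :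
    ∃ B : Matrix n n ℂ, A = Bᴴ * B := by
  obtain ⟨B, hB⟩ := CStarAlgebra.nonneg_iff_eq_star_mul_self.1 h.nonneg
  exact ⟨B, hB⟩

variable {N : ℕ} {d : Fin N → Type*} [∀ i, Fintype (d i)] [∀ i, DecidableEq (d i)]

lemma tensor_mul (A B : ∀ i, Matrix (d i) (d i) ℂ) :
    tensorMatrix A * tensorMatrix B = tensorMatrix (fun i => A i * B i) := by
  ext p q
  simp only [tensorMatrix, mul_apply, ← Finset.prod_mul_distrib]
  rw [Finset.prod_univ_sum, Fintype.piFinset_univ]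

lemma tensor_conj (A : ∀ i, Matrix (d i) (d i) ℂ) :
    (tensorMatrix A)ᴴ = tensorMatrix (fun i => (A i)ᴴ) := by
  ext p q
  simp [tensorMatrix, conjTranspose_apply]

lemma tensor_trace (A : ∀ i, Matrix (d i) (d i) ℂ) :
    (tensorMatrix A).trace = ∏ i, (A i).trace := by
  simp only [tensorMatrix, trace, diag_apply]
  rw [Finset.prod_univ_sum, Fintype.piFinset_univ]

lemma tensor_diag (f : ∀ i, d i → ℂ) :
    tensorMatrix (fun i => diagonal (f i)) = diagonal (fun p => ∏ i, f i (p i)) := by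
  ext p q
  by_cases h : p = q
  · subst h
    simp [tensorMatrix]
  · rw [diagonal_apply_ne _ h]
    obtain ⟨i, hi⟩ := Function.ne_iff.1 h
    exact Finset.prod_eq_zero (Finset.mem_univ i) (diagonal_apply_ne _ hi)

lemma tensor_one : tensorMatrix (fun i => (1 : Matrix (d i) (d i) ℂ)) = 1 := by
  have := tensor_diag (fun i (_ : d i) => (1 : ℂ))
  simpa using this

/-- Operator `B` acting on the `k`th factor. -/
def emb (k : Fin N) (B : Matrix (d k) (d k) ℂ) : Matrix (∀ i, d i) (∀ i, d i) ℂ :=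
  tensorMatrix (Function.update (fun i => (1 : Matrix (d i) (d i) ℂ)) k B)

lemma tensor_update_apply (A : ∀ i, Matrix (d i) (d i) ℂ) (k : Fin N) (B : Matrix (d k) (d k) ℂ)
    (p q : ∀ i, d i) : tensorMatrix (Function.update A k B) p q =
      B (p k) (q k) * ∏ j ∈ univ.erase k, A j (p j) (q j) := by
  rw [tensorMatrix, ← Finset.mul_prod_erase _ _ (Finset.mem_univ k), Function.update_self]
  congr 1
  refine Finset.prod_congr rfl fun j hj => ?_
  rw [Function.update_of_ne (Finset.ne_of_mem_erase hj)]

/-- `emb` as a linear map. -/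
def embL (k : Fin N) : Matrix (d k) (d k) ℂ →ₗ[ℂ] Matrix (∀ i, d i) (∀ i, d i) ℂ where
  toFun := emb k
  map_add' A B := by
    ext p q
    simp only [emb, Matrix.add_apply, tensor_update_apply]
    ring
  map_smul' c A := by
    ext p q
    simp only [emb, Matrix.smul_apply, tensor_update_apply, smul_eq_mul, RingHom.id_apply]
    ring

lemma emb_mul (k : Fin N) (A B : Matrix (d k) (d k) ℂ) : emb k A * emb k B = emb k (A * B) := by
  rw [emb, emb, emb, tensor_mul]
  congr 1
  ext1 i
  by_cases h : i = k
  · subst h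
    simp
  · simp [Function.update_of_ne h]

lemma emb_conj (k : Fin N) (A : Matrix (d k) (d k) ℂ) : (emb k A)ᴴ = emb k Aᴴ := by
  rw [emb, emb, tensor_conj]
  congr 1
  ext1 i
  by_cases h : i = k
  · subst h
    simp
  · simp [Function.update_of_ne h]

lemma emb_one (k : Fin N) : emb k (1 : Matrix (d k) (d k) ℂ) = 1 := by
  rw [emb, Function.update_eq_self, tensor_one]

/-- Marginal (partial trace over all factors but `k`). -/
def marg (k : Fin N) (X : Matrix (∀ i, d i) (∀ i, d i) ℂ) : Matrix (d k) (d k) ℂ :=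
  Matrix.of fun a b => (X * emb k (Matrix.single b a 1)).trace

/-- The marginal as a linear map. -/
def margL (k : Fin N) : Matrix (∀ i, d i) (∀ i, d i) ℂ →ₗ[ℂ] Matrix (d k) (d k) ℂ where
  toFun := marg k
  map_add' A B := by
    ext p q
    simp [marg, Matrix.add_mul]
  map_smul' c A := by
    ext p q
    simp [marg]

lemma marg_trace_mul (k : Fin N) (X : Matrix (∀ i, d i) (∀ i, d i) ℂ) (B : Matrix (d k) (d k) ℂ) :
    (marg k X * B).trace = (X * emb k B).trace := by
  have hB : emb k B = ∑ b, ∑ a, B b a • emb k (Matrix.single b a (1 : ℂ)) := by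
    conv_lhs => rw [matrix_eq_sum_single B]
    change embL k _ = _
    simp only [map_sum]
    refine Finset.sum_congr rfl fun b _ => Finset.sum_congr rfl fun a _ => ?_
    change _ = B b a • embL k _
    rw [← map_smul, smul_single, smul_eq_mul, mul_one]
  rw [hB]
  simp only [Matrix.mul_sum, trace_sum, Matrix.mul_smul, trace_smul, smul_eq_mul]
  rw [trace]
  simp only [diag_apply, mul_apply, marg, of_apply]
  rw [Finset.sum_comm]
  refine Finset.sum_congr rfl fun b _ => Finset.sum_congr rfl fun a _ => ?_
  rw [mul_comm]

lemma marg_density (k : Fin N) (X : Matrix (∀ i, d i) (∀ i, d i) ℂ) (h : IsDensity X) :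
    IsDensity (marg k X) := by
  constructor
  · refine Matrix.PosSemidef.of_dotProduct_mulVec_nonneg ?_ ?_
    · ext a b
      rw [conjTranspose_apply, marg, of_apply, of_apply, ← trace_conjTranspose, conjTranspose_mul,
        emb_conj, h.1.1, trace_mul_comm]
      simp
    · intro v
      have h1 : star v ⬝ᵥ (marg k X *ᵥ v) = (marg k X * vecMulVec v (star v)).trace := by
        rw [mul_vecMulVec, trace_vecMulVec, dotProduct_comm]
      have hP : (vecMulVec v (star v)).PosSemidef := posSemidef_vecMulVec_self_star v
      obtain ⟨B, hB⟩ := psd_factor hP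
      rw [h1, marg_trace_mul, hB, ← emb_mul, ← Matrix.mul_assoc, trace_mul_comm,
        ← Matrix.mul_assoc, ← emb_conj]
      exact (h.1.mul_mul_conjTranspose_same (emb k B)).trace_nonneg
  · have := marg_trace_mul k X 1
    rw [Matrix.mul_one, emb_one, Matrix.mul_one] at this
    rw [this, h.2]

lemma marg_tensor (k : Fin N) (A : ∀ i, Matrix (d i) (d i) ℂ) :
    marg k (tensorMatrix A) = (∏ j ∈ univ.erase k, (A j).trace) • A k := by
  ext a b
  rw [marg, of_apply, emb, tensor_mul, tensor_trace, ← Finset.mul_prod_erase _ _ (Finset.mem_univ k),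
    Function.update_self, Matrix.smul_apply, smul_eq_mul, mul_comm]
  congr 1
  · refine Finset.prod_congr rfl fun j hj => ?_
    rw [Function.update_of_ne (Finset.ne_of_mem_erase hj), Matrix.mul_one]
  · rw [trace_mul_single]
    simp

lemma single_tensor (p q : ∀ i, d i) :
    (Matrix.single p q (1 : ℂ)) = tensorMatrix (fun i => Matrix.single (p i) (q i) (1 : ℂ)) := by
  ext a b
  rw [single_apply, tensorMatrix]
  simp only [single_apply]
  rw [Finset.prod_ite_zero]
  simp [funext_iff, forall_and]

lemma marg_channel (T : ∀ k, Matrix (d k) (d k) ℂ → Matrix (d k) (d k) ℂ)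
    (hT : ∀ k, IsChannel (T k))
    (S : Matrix (∀ i, d i) (∀ i, d i) ℂ → Matrix (∀ i, d i) (∀ i, d i) ℂ)
    (hS : IsChannel S)
    (hSprod : ∀ A : ∀ i, Matrix (d i) (d i) ℂ,
      S (tensorMatrix A) = tensorMatrix (fun k => T k (A k)))
    (k : Fin N) (X : Matrix (∀ i, d i) (∀ i, d i) ℂ) :
    marg k (S X) = T k (marg k X) := by
  let SL := hS.1.mk' S
  let TL := (hT k).1.mk' (T k)
  have key : (margL k).comp SL = TL.comp (margL k) := by
    refine Matrix.ext_linearMap _ fun p q => LinearMap.ext_ring ?_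
    change marg k (S (Matrix.single p q 1)) = T k (marg k (Matrix.single p q 1))
    rw [single_tensor, hSprod, marg_tensor, marg_tensor, (hT k).1.map_smul]
    congr 1
    exact Finset.prod_congr rfl fun j _ => (hT j).2.2 _
  exact LinearMap.congr_fun key X

/-- `∑ q log ∏ m_k = ∑_k ∑ m_k log m_k`. -/
lemma sum_log_prod (q : (∀ i, d i) → ℝ) (m : ∀ i, d i → ℝ)
    (hm : ∀ k x, m k x = ∑ p, if p k = x then q p else 0)
    (hpos : ∀ p, q p ≠ 0 → ∀ k, m k (p k) ≠ 0) :
    ∑ p, q p * Real.log (∏ k, m k (p k)) = - ∑ k, ∑ x, Real.negMulLog (m k x) := by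
  have h1 : ∀ p, q p * Real.log (∏ k, m k (p k)) = ∑ k, q p * Real.log (m k (p k)) := by
    intro p
    by_cases h : q p = 0
    · simp [h]
    · rw [Real.log_prod (fun k _ => hpos p h k), Finset.mul_sum]
  simp_rw [h1]
  rw [Finset.sum_comm, ← Finset.sum_neg_distrib]
  refine Finset.sum_congr rfl fun k _ => ?_
  rw [← Finset.sum_neg_distrib]
  have h2 : ∀ x, - Real.negMulLog (m k x) = ∑ p, if p k = x then q p * Real.log (m k x) else 0 := by
    intro x
    rw [Real.negMulLog, neg_mul, neg_neg]
    nth_rewrite 1 [hm k x]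
    rw [Finset.sum_mul]
    refine Finset.sum_congr rfl fun p _ => ?_
    split_ifs <;> simp
  simp_rw [h2]
  rw [Finset.sum_comm]
  refine Finset.sum_congr rfl fun p _ => ?_
  simp

lemma sum_marg (f : ∀ i, d i → ℝ) (h1 : ∀ i, ∑ x, f i x = 1) (k : Fin N) (x : d k) :
    f k x = ∑ p : ∀ i, d i, if p k = x then ∏ i, f i (p i) else 0 := by
  have h := Finset.prod_univ_sum (fun i => (univ : Finset (d i)))
    (Function.update f k (fun y => if y = x then f k y else 0))
  rw [Fintype.piFinset_univ, ← Finset.mul_prod_erase _ _ (Finset.mem_univ k),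
    Function.update_self] at h
  rw [Finset.prod_eq_one (s := univ.erase k)] at h
  · simp only [Finset.sum_ite_eq', Finset.mem_univ, if_true, mul_one] at h
    rw [h]
    refine Finset.sum_congr rfl fun p _ => ?_
    rw [← Finset.mul_prod_erase _ _ (Finset.mem_univ k), Function.update_self,
      ← Finset.mul_prod_erase (univ) (fun i => f i (p i)) (Finset.mem_univ k), ite_mul, zero_mul]
    have : ∏ j ∈ univ.erase k, Function.update f k (fun y => if y = x then f k y else 0) j (p j)
        = ∏ j ∈ univ.erase k, f j (p j) := by
      refine Finset.prod_congr rfl fun j hj => ?_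
      rw [Function.update_of_ne (Finset.ne_of_mem_erase hj)]
    rw [this]
  · intro j hj
    rw [Function.update_of_ne (Finset.ne_of_mem_erase hj)]
    exact h1 j

lemma vN_tensor (A : ∀ i, Matrix (d i) (d i) ℂ) (hA : ∀ i, IsDensity (A i)) :
    vN (tensorMatrix A) = ∑ k, vN (A k) := by
  choose U f hU hU' hAU hf hf1 using fun i => density_diag (A i) (hA i)
  have hd : tensorMatrix A = tensorMatrix U * diagonal (fun p => ((∏ i, f i (p i) : ℝ) : ℂ))
      * (tensorMatrix U)ᴴ := by
    push_cast
    rw [← tensor_diag (fun i x => (f i x : ℂ)), tensor_conj, tensor_mul, tensor_mul]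
    congr 1
    ext1 i
    exact hAU i
  have hUU : (tensorMatrix U)ᴴ * tensorMatrix U = 1 := by
    rw [tensor_conj, tensor_mul]
    simp_rw [hU]
    exact tensor_one
  rw [vN_of_diag _ _ _ hUU hd]
  simp_rw [fun k => vN_of_diag (A k) (U k) (f k) (hU k) (hAU k)]
  rw [← Finset.sum_div]
  congr 1
  have := sum_log_prod (fun p => ∏ i, f i (p i)) f (sum_marg f hf1)
    (fun p hp k => Finset.prod_ne_zero_iff.1 hp k (Finset.mem_univ k))
  rw [← neg_eq_iff_eq_neg] at this
  rw [← this, ← Finset.sum_neg_distrib]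
  refine Finset.sum_congr rfl fun p _ => ?_
  rw [Real.negMulLog, neg_mul]

lemma tensor_density (A : ∀ i, Matrix (d i) (d i) ℂ) (hA : ∀ i, IsDensity (A i)) :
    IsDensity (tensorMatrix A) := by
  constructor
  · choose B hB using fun i => psd_factor (hA i).1
    have : tensorMatrix A = (tensorMatrix B)ᴴ * tensorMatrix B := by
      rw [tensor_conj, tensor_mul]
      congr 1
      ext1 i
      exact hB i
    rw [this]
    exact posSemidef_conjTranspose_mul_self _
  · rw [tensor_trace]
    exact Finset.prod_eq_one fun i _ => (hA i).2

/-- Subadditivity of the von Neumann entropy. -/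
lemma vN_subadd (X : Matrix (∀ i, d i) (∀ i, d i) ℂ) (h : IsDensity X) :
    vN X ≤ ∑ k, vN (marg k X) := by
  choose U m hU hU' hXU hm hm1 using fun k => density_diag (marg k X) (marg_density k X h)
  have hUU : (tensorMatrix U)ᴴ * tensorMatrix U = 1 := by
    rw [tensor_conj, tensor_mul]
    simp_rw [hU]
    exact tensor_one
  have hUU' : tensorMatrix U * (tensorMatrix U)ᴴ = 1 := by
    rw [tensor_conj, tensor_mul]
    simp_rw [hU']
    exact tensor_one
  refine (vN_le_diag X (tensorMatrix U) h hUU hUU').trans ?_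
  simp_rw [fun k => vN_of_diag (marg k X) (U k) (m k) (hU k) (hXU k)]
  rw [← Finset.sum_div]
  refine div_le_div_of_nonneg_right ?_ (Real.log_nonneg (by norm_num))
  set Y := (tensorMatrix U)ᴴ * X * tensorMatrix U with hY
  have hYP : Y.PosSemidef := h.1.conjTranspose_mul_mul_same _
  set q : (∀ i, d i) → ℝ := fun p => (Y p p).re with hq
  have hq0 : ∀ p, 0 ≤ q p := fun p => (Complex.le_def.1 (hYP.diag_nonneg (i := p))).1
  have hq1 : ∑ p, q p = 1 := by
    have : Y.trace = 1 := by
      rw [hY, trace_mul_comm, ← Matrix.mul_assoc, hUU', Matrix.one_mul, h.2]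
    have := congrArg Complex.re this
    simpa [trace, hq] using this
  have hmarg : ∀ k x, m k x = ∑ p, if p k = x then q p else 0 := by
    intro k x
    have e1 : (marg k X * (U k * Matrix.single x x 1 * (U k)ᴴ)).trace = (m k x : ℂ) := by
      rw [hXU k]
      have : U k * diagonal (fun i => (m k i : ℂ)) * (U k)ᴴ * (U k * Matrix.single x x 1 * (U k)ᴴ)
          = U k * (diagonal (fun i => (m k i : ℂ)) * ((U k)ᴴ * U k) * Matrix.single x x 1) *
            (U k)ᴴ := by
        simp only [Matrix.mul_assoc]
      rw [this, hU, Matrix.mul_one, trace_mul_comm, ← Matrix.mul_assoc, hU, Matrix.one_mul,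
        trace_mul_single]
      simp
    have e2 : emb k (U k * Matrix.single x x 1 * (U k)ᴴ) =
        tensorMatrix U * diagonal (fun p => if p k = x then (1 : ℂ) else 0) * (tensorMatrix U)ᴴ := by
      have : (diagonal (fun p : ∀ i, d i => if p k = x then (1 : ℂ) else 0)) =
          emb k (Matrix.single x x 1) := by
        ext p p'
        rw [emb, tensor_update_apply, single_apply]
        by_cases hp : p = p'
        · subst hp
          simp [eq_comm]
        · rw [diagonal_apply_ne _ hp]
          symm
          obtain ⟨i, hi⟩ := Function.ne_iff.1 hp
          by_cases hik : i = k
          · subst hik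
            rw [if_neg, zero_mul]
            rintro ⟨h1, h2⟩
            exact hi (h1.symm.trans h2)
          · refine mul_eq_zero_of_right _ (Finset.prod_eq_zero (i := i) (by simp [hik]) ?_)
            exact one_apply_ne hi
      rw [this, emb, emb, tensor_conj, tensor_mul, tensor_mul]
      congr 1
      ext1 i
      by_cases hik : i = k
      · subst hik
        simp
      · simp [Function.update_of_ne hik, hU']
    rw [marg_trace_mul, e2, ← Matrix.mul_assoc, trace_mul_comm, ← Matrix.mul_assoc,
      ← Matrix.mul_assoc, ← hY] at e1
    have := congrArg Complex.re e1
    simp only [trace, diag_apply, mul_diagonal, Complex.re_sum, Complex.ofReal_re] at this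
    rw [← this]
    refine Finset.sum_congr rfl fun p _ => ?_
    split_ifs <;> simp [hq]
  have hpos : ∀ p, q p ≠ 0 → ∀ k, m k (p k) ≠ 0 := by
    intro p hp k
    have hp' : 0 < q p := lt_of_le_of_ne (hq0 p) (Ne.symm hp)
    refine (lt_of_lt_of_le hp' ?_).ne'
    rw [hmarg]
    refine le_trans ?_ (Finset.single_le_sum (fun p' _ => ?_) (Finset.mem_univ p))
    · simp
    · split_ifs
      · exact hq0 _
      · exact le_rfl
  have hs := sum_log_prod q m hmarg hpos
  rw [← neg_eq_iff_eq_neg] at hs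
  rw [← hs, ← Finset.sum_neg_distrib]
  have hprod1 : ∑ p : ∀ i, d i, ∏ k, m k (p k) = 1 := by
    have := Finset.prod_univ_sum (fun i => (univ : Finset (d i))) m
    rw [Fintype.piFinset_univ] at this
    rw [← this]
    exact Finset.prod_eq_one fun i _ => hm1 i
  have hterm : ∀ p, Real.negMulLog (q p) ≤
      -(q p * Real.log (∏ k, m k (p k))) + (∏ k, m k (p k) - q p) := by
    intro p
    have hM0 : 0 ≤ ∏ k, m k (p k) := Finset.prod_nonneg fun k _ => hm k _
    by_cases hp : q p = 0
    · simp [hp, hM0]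
    · have hp' : 0 < q p := lt_of_le_of_ne (hq0 p) (Ne.symm hp)
      have hM : 0 < ∏ k, m k (p k) :=
        lt_of_le_of_ne hM0 (Ne.symm (Finset.prod_ne_zero_iff.2 fun k _ => hpos p hp k))
      have := Real.log_le_sub_one_of_pos (div_pos hM hp')
      rw [Real.log_div hM.ne' hp] at this
      have h3 := mul_le_mul_of_nonneg_left this hp'.le
      have h4 : q p * ((∏ k, m k (p k)) / q p - 1) = ∏ k, m k (p k) - q p := by
        field_simp
      rw [h4] at h3
      rw [Real.negMulLog]
      linarith
  calc _ ≤ ∑ p, (-(q p * Real.log (∏ k, m k (p k))) + (∏ k, m k (p k) - q p)) :=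
        Finset.sum_le_sum fun p _ => hterm p
    _ = _ := by
        rw [Finset.sum_add_distrib, Finset.sum_sub_distrib, hprod1, hq1, sub_self, add_zero]

end tensor

end HolevoAux

/-- strong additivity of the Holevo capacity for weakly covariant channels
with strongly additive minimal output entropy. -/
theorem holevoCap_strongly_additive {N : ℕ} {d : Fin N → Type*}
    [∀ i, Fintype (d i)] [∀ i, DecidableEq (d i)]
    (T : ∀ k, Matrix (d k) (d k) ℂ → Matrix (d k) (d k) ℂ)
    (hT : ∀ k, IsChannel (T k))
    (hens : ∀ k, ∃ (m : ℕ) (p : Fin (m + 1) → ℝ) (ρ : Fin (m + 1) → Matrix (d k) (d k) ℂ),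
      (∀ i, 0 ≤ p i) ∧ (∑ i, p i = 1) ∧ (∀ i, IsDensity (ρ i)) ∧
      (∀ i, vN (T k (ρ i)) = minOut (T k) 1) ∧
      vN (T k (∑ i, (p i : ℂ) • ρ i)) = maxVN (T k))
    (S : Matrix (∀ i, d i) (∀ i, d i) ℂ → Matrix (∀ i, d i) (∀ i, d i) ℂ)
    (hSchan : IsChannel S)
    (hSprod : ∀ A : ∀ i, Matrix (d i) (d i) ℂ,
      S (tensorMatrix A) = tensorMatrix (fun k => T k (A k)))
    (hadd : minOut S 1 = ∑ k, minOut (T k) 1) :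
    holevoCap S = ∑ k, holevoCap (T k) := by
  classical
  choose m p ρ hp hp1 hρ hmin hmax using hens
  have hTcap : ∀ k, holevoCap (T k) = maxVN (T k) - minOut (T k) 1 := fun k =>
    HolevoAux.cap_eq (T k) (hT k) _ (HolevoAux.vN_le_maxVN (T k) (hT k)) (p k) (ρ k) (hp k) (hp1 k)
      (hρ k) (fun i => (hmin k i).le) (hmax k).ge
  have hdens : ∀ k i, IsDensity (T k (ρ k i)) := fun k i =>
    HolevoAux.channel_density (T k) (hT k) _ (hρ k i)
  have hSavg : (∑ i : ∀ k, Fin (m k + 1), ((∏ k, p k (i k) : ℝ) : ℂ) •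
      tensorMatrix (fun k => ρ k (i k))) = tensorMatrix (fun k => ∑ i, (p k i : ℂ) • ρ k i) := by
    ext a b
    simp only [Matrix.sum_apply, Matrix.smul_apply, tensorMatrix, smul_eq_mul]
    rw [Finset.prod_univ_sum, Fintype.piFinset_univ]
    refine Finset.sum_congr rfl fun i _ => ?_
    rw [Finset.prod_mul_distrib]
    push_cast
    rfl
  have hScap : holevoCap S = ∑ k, maxVN (T k) - minOut S 1 := by
    refine HolevoAux.cap_eq S hSchan _ ?_ (k := ∀ k, Fin (m k + 1))
      (fun i => ∏ k, p k (i k)) (fun i => tensorMatrix (fun k => ρ k (i k))) ?_ ?_ ?_ ?_ ?_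
    · intro X hX
      refine (HolevoAux.vN_subadd _ (HolevoAux.channel_density S hSchan X hX)).trans ?_
      refine Finset.sum_le_sum fun k _ => ?_
      rw [HolevoAux.marg_channel T hT S hSchan hSprod]
      exact HolevoAux.vN_le_maxVN _ (hT k) _ (HolevoAux.marg_density k X hX)
    · exact fun i => Finset.prod_nonneg fun k _ => hp k _
    · have := Finset.prod_univ_sum (fun i => (Finset.univ : Finset (Fin (m i + 1)))) p
      rw [Fintype.piFinset_univ] at this
      rw [← this]
      exact Finset.prod_eq_one fun k _ => hp1 k
    · exact fun i => HolevoAux.tensor_density _ fun k => hρ k _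
    · intro i
      rw [hSprod, HolevoAux.vN_tensor _ (fun k => hdens k (i k)), hadd]
      exact Finset.sum_le_sum fun k _ => (hmin k _).le
    · rw [hSavg, hSprod, HolevoAux.vN_tensor _ (fun k => HolevoAux.channel_density (T k) (hT k) _
        (HolevoAux.convex_density (p k) (ρ k) (hp k) (hp1 k) (hρ k)))]
      exact Finset.sum_le_sum fun k _ => (hmax k).ge
  rw [hScap, hadd, ← Finset.sum_sub_distrib]
  exact Finset.sum_congr rfl fun k _ => (hTcap k).symm
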